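/- Let V and W be simple 𝔤₀-supermodules. Every non-zero homomorphism of 𝔤-supermodules f : K(V) → K'(W) has image equal to the socle of K'(W). Consequently, if K(V) ≅ K'(W) as 𝔤-supermodules, then both K(V) and K'(W) are simple. -/

import Mathlib

noncomputable section

open Module Function

/-- A complex Lie superalgebra `𝔤 = 𝔤₀̄ ⊕ 𝔤₁̄` equipped with a compatible `ℤ`-grading
`𝔤 = 𝔤₋₁ ⊕ 𝔤₀ ⊕ 𝔤₁`, i.e. `𝔤₀ = 𝔤₀̄`, `𝔤₁̄ = 𝔤₁ ⊕ 𝔤₋₁`, the pieces `𝔤±₁` are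
`𝔤₀̄`-submodules and `[𝔤₁,𝔤₁] = [𝔤₋₁,𝔤₋₁] = 0`.  The super skew-symmetry and the super
Jacobi identity are imposed on (parity-)homogeneous elements, as usual. -/
structure GLSA where
  carrier : Type
  [isACG : AddCommGroup carrier]
  [isMod : Module ℂ carrier]
  bracket : carrier →ₗ[ℂ] carrier →ₗ[ℂ] carrier
  gneg : Submodule ℂ carrier
  g0 : Submodule ℂ carrier
  gpos : Submodule ℂ carrier
  oddCompl : IsCompl g0 (gneg ⊔ gpos)
  disjNP : Disjoint gneg gpos
  br_00 : ∀ x ∈ g0, ∀ y ∈ g0, bracket x y ∈ g0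
  br_0p : ∀ x ∈ g0, ∀ y ∈ gpos, bracket x y ∈ gpos
  br_0n : ∀ x ∈ g0, ∀ y ∈ gneg, bracket x y ∈ gneg
  br_pn : ∀ x ∈ gpos, ∀ y ∈ gneg, bracket x y ∈ g0
  br_pp : ∀ x ∈ gpos, ∀ y ∈ gpos, bracket x y = 0
  br_nn : ∀ x ∈ gneg, ∀ y ∈ gneg, bracket x y = 0
  skew_e : ∀ x ∈ g0, ∀ y, bracket x y = - bracket y x
  skew_oo : ∀ x ∈ gneg ⊔ gpos, ∀ y ∈ gneg ⊔ gpos, bracket x y = bracket y x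
  jacobi_e : ∀ x y z : carrier, (x ∈ g0 ∨ y ∈ g0) →
    bracket x (bracket y z) = bracket (bracket x y) z + bracket y (bracket x z)
  jacobi_oo : ∀ x ∈ gneg ⊔ gpos, ∀ y ∈ gneg ⊔ gpos, ∀ z,
    bracket x (bracket y z) = bracket (bracket x y) z - bracket y (bracket x z)

attribute [instance] GLSA.isACG GLSA.isMod

/-- The odd part `𝔤₁̄ = 𝔤₋₁ ⊕ 𝔤₁` of `L`. -/
def GLSA.odd (L : GLSA) : Submodule ℂ L.carrier := L.gneg ⊔ L.gpos

/-- A `𝔤`-supermodule: a `ℤ₂`-graded complex vector space with a compatible action of the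
Lie superalgebra `L` (signs in the compatibility with the bracket are imposed on
homogeneous elements). -/
structure SMod (L : GLSA) where
  carrier : Type
  [isACG : AddCommGroup carrier]
  [isMod : Module ℂ carrier]
  act : L.carrier →ₗ[ℂ] carrier →ₗ[ℂ] carrier
  ev : Submodule ℂ carrier
  od : Submodule ℂ carrier
  grading : IsCompl ev od
  act_e_ev : ∀ x ∈ L.g0, ∀ m ∈ ev, act x m ∈ ev
  act_e_od : ∀ x ∈ L.g0, ∀ m ∈ od, act x m ∈ od
  act_o_ev : ∀ x ∈ L.odd, ∀ m ∈ ev, act x m ∈ od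
  act_o_od : ∀ x ∈ L.odd, ∀ m ∈ od, act x m ∈ ev
  act_br_e : ∀ x y : L.carrier, (x ∈ L.g0 ∨ y ∈ L.g0) → ∀ m,
    act (L.bracket x y) m = act x (act y m) - act y (act x m)
  act_br_oo : ∀ x ∈ L.odd, ∀ y ∈ L.odd, ∀ m,
    act (L.bracket x y) m = act x (act y m) + act y (act x m)

attribute [instance] SMod.isACG SMod.isMod

/-- A `𝔤₀̄`-supermodule: a `ℤ₂`-graded complex vector space with an action of the (purely
even) Lie algebra `𝔤₀̄ = 𝔤₀` preserving the grading. -/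
structure SMod0 (L : GLSA) where
  carrier : Type
  [isACG : AddCommGroup carrier]
  [isMod : Module ℂ carrier]
  act : ↥L.g0 →ₗ[ℂ] carrier →ₗ[ℂ] carrier
  ev : Submodule ℂ carrier
  od : Submodule ℂ carrier
  grading : IsCompl ev od
  act_ev : ∀ (x : L.g0), ∀ m ∈ ev, act x m ∈ ev
  act_od : ∀ (x : L.g0), ∀ m ∈ od, act x m ∈ od
  act_br : ∀ (x y : L.g0) (m : carrier),
    act ⟨L.bracket ↑x ↑y, L.br_00 ↑x x.2 ↑y y.2⟩ m = act x (act y m) - act y (act x m)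

attribute [instance] SMod0.isACG SMod0.isMod

/-- A homomorphism of `𝔤`-supermodules (homogeneous of degree zero). -/
structure SHom {L : GLSA} (M N : SMod L) where
  toLin : M.carrier →ₗ[ℂ] N.carrier
  map_ev : ∀ m ∈ M.ev, toLin m ∈ N.ev
  map_od : ∀ m ∈ M.od, toLin m ∈ N.od
  equivar : ∀ (x : L.carrier) (m : M.carrier), toLin (M.act x m) = N.act x (toLin m)

/-- Isomorphism of `𝔤`-supermodules. -/
def SIso {L : GLSA} (M N : SMod L) : Prop := ∃ f : SHom M N, Bijective f.toLin

/-- Isomorphism of `𝔤₀̄`-supermodules. -/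
def SIso0 {L : GLSA} (V W : SMod0 L) : Prop :=
  ∃ e : V.carrier ≃ₗ[ℂ] W.carrier,
    (∀ v ∈ V.ev, e v ∈ W.ev) ∧ (∀ v ∈ V.od, e v ∈ W.od) ∧
    (∀ (x : L.g0) (v : V.carrier), e (V.act x v) = W.act x (e v))

/-- Isomorphism of `𝔤`-supermodules up to parity change. -/
def SIsoUpToParity {L : GLSA} (M N : SMod L) : Prop :=
  ∃ e : M.carrier ≃ₗ[ℂ] N.carrier,
    (∀ (x : L.carrier) (m : M.carrier), e (M.act x m) = N.act x (e m)) ∧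
    (((∀ m ∈ M.ev, e m ∈ N.ev) ∧ (∀ m ∈ M.od, e m ∈ N.od)) ∨
     ((∀ m ∈ M.ev, e m ∈ N.od) ∧ (∀ m ∈ M.od, e m ∈ N.ev)))

namespace SMod

variable {L : GLSA}

/-- A (graded) sub-supermodule of a `𝔤`-supermodule. -/
def IsSubmod (M : SMod L) (N : Submodule ℂ M.carrier) : Prop :=
  (∀ (x : L.carrier), ∀ m ∈ N, M.act x m ∈ N) ∧ N ≤ (N ⊓ M.ev) ⊔ (N ⊓ M.od)

/-- A simple sub-supermodule. -/
def IsSimpleSub (M : SMod L) (N : Submodule ℂ M.carrier) : Prop :=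
  M.IsSubmod N ∧ N ≠ ⊥ ∧ ∀ N', M.IsSubmod N' → N' ≤ N → N' = ⊥ ∨ N' = N

/-- The socle: the sum of all simple sub-supermodules. -/
def socle (M : SMod L) : Submodule ℂ M.carrier := sSup {N | M.IsSimpleSub N}

/-- The sub-supermodule generated by a subspace, i.e. `U(𝔤)·S`. -/
def gen (M : SMod L) (S : Submodule ℂ M.carrier) : Submodule ℂ M.carrier :=
  sInf {N | M.IsSubmod N ∧ S ≤ N}

/-- Simplicity of a `𝔤`-supermodule. -/
def IsSimple (M : SMod L) : Prop :=
  (⊤ : Submodule ℂ M.carrier) ≠ ⊥ ∧ ∀ N, M.IsSubmod N → N = ⊥ ∨ N = ⊤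

/-- Indecomposability of a `𝔤`-supermodule. -/
def Indecomposable (M : SMod L) : Prop :=
  (⊤ : Submodule ℂ M.carrier) ≠ ⊥ ∧
  ∀ N₁ N₂, M.IsSubmod N₁ → M.IsSubmod N₂ → N₁ ⊓ N₂ = ⊥ → N₁ ⊔ N₂ = ⊤ →
    N₁ = ⊥ ∨ N₂ = ⊥

/-- The parity change functor `Π`. -/
def pshift (M : SMod L) : SMod L where
  carrier := M.carrier
  act := M.act
  ev := M.od
  od := M.ev
  grading := M.grading.symm
  act_e_ev := M.act_e_od
  act_e_od := M.act_e_ev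
  act_o_ev := M.act_o_od
  act_o_od := M.act_o_ev
  act_br_e := M.act_br_e
  act_br_oo := M.act_br_oo

/-- The space `M^{𝔤₁}` of `𝔤₁`-invariants. -/
def invPos (M : SMod L) : Submodule ℂ M.carrier where
  carrier := {m | ∀ x ∈ L.gpos, M.act x m = 0}
  add_mem' := by
    intro a b ha hb x hx
    rw [map_add, ha x hx, hb x hx, add_zero]
  zero_mem' := by intro x hx; simp
  smul_mem' := by
    intro c a ha x hx
    rw [map_smul, ha x hx, smul_zero]

/-- The space `M^{𝔤₋₁}` of `𝔤₋₁`-invariants. -/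
def invNeg (M : SMod L) : Submodule ℂ M.carrier where
  carrier := {m | ∀ x ∈ L.gneg, M.act x m = 0}
  add_mem' := by
    intro a b ha hb x hx
    rw [map_add, ha x hx, hb x hx, add_zero]
  zero_mem' := by intro x hx; simp
  smul_mem' := by
    intro c a ha x hx
    rw [map_smul, ha x hx, smul_zero]

/-- Iterated action of a list of elements of `𝔤`. -/
def actList (M : SMod L) : List L.carrier → M.carrier → M.carrier
  | [], m => m
  | x :: xs, m => M.act x (M.actList xs m)

end SMod

namespace SMod0

variable {L : GLSA}

/-- A (graded) sub-supermodule of a `𝔤₀̄`-supermodule. -/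
def IsSubmod (V : SMod0 L) (N : Submodule ℂ V.carrier) : Prop :=
  (∀ (x : L.g0), ∀ v ∈ N, V.act x v ∈ N) ∧ N ≤ (N ⊓ V.ev) ⊔ (N ⊓ V.od)

/-- Simplicity of a `𝔤₀̄`-supermodule. -/
def IsSimple (V : SMod0 L) : Prop :=
  (⊤ : Submodule ℂ V.carrier) ≠ ⊥ ∧ ∀ N, V.IsSubmod N → N = ⊥ ∨ N = ⊤

end SMod0

/-- `IsKac V K η` expresses that `K`, together with the (even, `𝔤₀̄`-equivariant) unit map
`η : V → K` whose image is annihilated by `𝔤₁`, is *the* Kac module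
`K(V) = Ind_{𝔤≥0}^{𝔤} V` of the `𝔤₀̄`-supermodule `V` (on which `𝔤₁` acts by zero), i.e.
satisfies the universal property `Hom_𝔤(K(V), M) = Hom_{𝔤₀̄}(V, M^{𝔤₁})`. -/
structure IsKac {L : GLSA} (V : SMod0 L) (K : SMod L) (η : V.carrier →ₗ[ℂ] K.carrier) : Prop where
  map_ev : ∀ v ∈ V.ev, η v ∈ K.ev
  map_od : ∀ v ∈ V.od, η v ∈ K.od
  equivar : ∀ (x : L.g0) (v : V.carrier), η (V.act x v) = K.act ↑x (η v)
  pos_zero : ∀ x ∈ L.gpos, ∀ v : V.carrier, K.act x (η v) = 0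
  injective : Injective η
  generates : K.gen (LinearMap.range η) = ⊤
  universal : ∀ (M : SMod L) (φ : V.carrier →ₗ[ℂ] M.carrier),
    (∀ v ∈ V.ev, φ v ∈ M.ev) → (∀ v ∈ V.od, φ v ∈ M.od) →
    (∀ (x : L.g0) (v : V.carrier), φ (V.act x v) = M.act ↑x (φ v)) →
    (∀ x ∈ L.gpos, ∀ v : V.carrier, M.act x (φ v) = 0) →
    ∃! Φ : SHom K M, ∀ v, Φ.toLin (η v) = φ v

/-- The opposite Kac module `K'(V) = Ind_{𝔤≤0}^{𝔤} V` (with `𝔤₋₁` acting by zero on `V`),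
described by its universal property. -/
structure IsKac' {L : GLSA} (V : SMod0 L) (K : SMod L) (η : V.carrier →ₗ[ℂ] K.carrier) : Prop where
  map_ev : ∀ v ∈ V.ev, η v ∈ K.ev
  map_od : ∀ v ∈ V.od, η v ∈ K.od
  equivar : ∀ (x : L.g0) (v : V.carrier), η (V.act x v) = K.act ↑x (η v)
  neg_zero : ∀ x ∈ L.gneg, ∀ v : V.carrier, K.act x (η v) = 0
  injective : Injective η
  generates : K.gen (LinearMap.range η) = ⊤
  universal : ∀ (M : SMod L) (φ : V.carrier →ₗ[ℂ] M.carrier),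
    (∀ v ∈ V.ev, φ v ∈ M.ev) → (∀ v ∈ V.od, φ v ∈ M.od) →
    (∀ (x : L.g0) (v : V.carrier), φ (V.act x v) = M.act ↑x (φ v)) →
    (∀ x ∈ L.gneg, ∀ v : V.carrier, M.act x (φ v) = 0) →
    ∃! Φ : SHom K M, ∀ v, Φ.toLin (η v) = φ v

/-- `IsCoindPos W C ε` expresses that `C`, together with the (even, `𝔤₀̄`-equivariant)
counit `ε : C → W` killing `𝔤₁·C`, is the coinduced module `Coind_{𝔤≥0}^{𝔤}(W)` of the
`𝔤₀̄`-supermodule `W` (with `𝔤₁` acting by zero), i.e. satisfies the universal property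
`Hom_𝔤(M, Coind(W)) = Hom_{𝔤≥0}(Res M, W)`. -/
structure IsCoindPos {L : GLSA} (W : SMod0 L) (C : SMod L) (ε : C.carrier →ₗ[ℂ] W.carrier) : Prop where
  map_ev : ∀ c ∈ C.ev, ε c ∈ W.ev
  map_od : ∀ c ∈ C.od, ε c ∈ W.od
  equivar : ∀ (x : L.g0) (c : C.carrier), ε (C.act ↑x c) = W.act x (ε c)
  pos_zero : ∀ x ∈ L.gpos, ∀ c : C.carrier, ε (C.act x c) = 0
  universal : ∀ (M : SMod L) (ψ : M.carrier →ₗ[ℂ] W.carrier),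
    (∀ m ∈ M.ev, ψ m ∈ W.ev) → (∀ m ∈ M.od, ψ m ∈ W.od) →
    (∀ (x : L.g0) (m : M.carrier), ψ (M.act ↑x m) = W.act x (ψ m)) →
    (∀ x ∈ L.gpos, ∀ m : M.carrier, ψ (M.act x m) = 0) →
    ∃! Φ : SHom M C, ∀ m, ε (Φ.toLin m) = ψ m

/-- `Coind_{𝔤≤0}^{𝔤}(W)`, by its universal property. -/
structure IsCoindNeg {L : GLSA} (W : SMod0 L) (C : SMod L) (ε : C.carrier →ₗ[ℂ] W.carrier) : Prop where
  map_ev : ∀ c ∈ C.ev, ε c ∈ W.ev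
  map_od : ∀ c ∈ C.od, ε c ∈ W.od
  equivar : ∀ (x : L.g0) (c : C.carrier), ε (C.act ↑x c) = W.act x (ε c)
  neg_zero : ∀ x ∈ L.gneg, ∀ c : C.carrier, ε (C.act x c) = 0
  universal : ∀ (M : SMod L) (ψ : M.carrier →ₗ[ℂ] W.carrier),
    (∀ m ∈ M.ev, ψ m ∈ W.ev) → (∀ m ∈ M.od, ψ m ∈ W.od) →
    (∀ (x : L.g0) (m : M.carrier), ψ (M.act ↑x m) = W.act x (ψ m)) →
    (∀ x ∈ L.gneg, ∀ m : M.carrier, ψ (M.act x m) = 0) →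
    ∃! Φ : SHom M C, ∀ m, ε (Φ.toLin m) = ψ m

/-- The subspace `Λ^max(𝔤₋₁) ⊗ V ⊆ K(V)`: the span of all elements obtained by acting on
`η(V)` with `dim 𝔤₋₁` many elements of `𝔤₋₁`. -/
def botPartNeg {L : GLSA} (V : SMod0 L) (K : SMod L) (η : V.carrier →ₗ[ℂ] K.carrier) :
    Submodule ℂ K.carrier :=
  Submodule.span ℂ {m | ∃ (xs : List L.carrier) (v : V.carrier),
    xs.length = finrank ℂ ↥L.gneg ∧ (∀ x ∈ xs, x ∈ L.gneg) ∧ m = K.actList xs (η v)}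

/-- The subspace `Λ^max(𝔤₁) ⊗ V ⊆ K'(V)`. -/
def botPartPos {L : GLSA} (V : SMod0 L) (K : SMod L) (η : V.carrier →ₗ[ℂ] K.carrier) :
    Submodule ℂ K.carrier :=
  Submodule.span ℂ {m | ∃ (xs : List L.carrier) (v : V.carrier),
    xs.length = finrank ℂ ↥L.gpos ∧ (∀ x ∈ xs, x ∈ L.gpos) ∧ m = K.actList xs (η v)}

/-- For `x ∈ 𝔤₀̄`, the operator `ad x` restricted to `𝔤₁`. -/
def adPos (L : GLSA) (x : L.g0) : ↥L.gpos →ₗ[ℂ] ↥L.gpos :=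
  (L.bracket ↑x).restrict (fun y hy => L.br_0p ↑x x.2 y hy)

/-- For `x ∈ 𝔤₀̄`, the operator `ad x` restricted to `𝔤₋₁`. -/
def adNeg (L : GLSA) (x : L.g0) : ↥L.gneg →ₗ[ℂ] ↥L.gneg :=
  (L.bracket ↑x).restrict (fun y hy => L.br_0n ↑x x.2 y hy)

/-- The character by which `𝔤₀̄` acts on the one-dimensional module `Λ^max(𝔤₁)`. -/
def traceCharPos (L : GLSA) (x : L.g0) : ℂ := LinearMap.trace ℂ ↥L.gpos (adPos L x)

/-- The character by which `𝔤₀̄` acts on the one-dimensional module `Λ^max(𝔤₋₁)`. -/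
def traceCharNeg (L : GLSA) (x : L.g0) : ℂ := LinearMap.trace ℂ ↥L.gneg (adNeg L x)

/-- `IsTwistBy V W χ swap` expresses that `W ≅ ℂ_χ ⊗ V` as `𝔤₀̄`-supermodules, where `ℂ_χ`
is the one-dimensional module with character `χ`, of odd parity iff `swap = true`.
Taking `χ` to be `traceCharPos`/`traceCharNeg` (resp. their negatives) and `swap` the parity
of `dim 𝔤±₁` expresses `W ≅ Λ^max(𝔤±₁) ⊗ V` (resp. `W ≅ Λ^max(𝔤±₁^*) ⊗ V`). -/
def IsTwistBy {L : GLSA} (V W : SMod0 L) (χ : ↥L.g0 → ℂ) (swap : Bool) : Prop :=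
  ∃ e : V.carrier ≃ₗ[ℂ] W.carrier,
    (∀ (x : L.g0) (v : V.carrier), W.act x (e v) = e (V.act x v) + χ x • e v) ∧
    (if swap then (∀ v ∈ V.ev, e v ∈ W.od) ∧ (∀ v ∈ V.od, e v ∈ W.ev)
     else (∀ v ∈ V.ev, e v ∈ W.ev) ∧ (∀ v ∈ V.od, e v ∈ W.od))

/-- Parity (as a `Bool`) of `dim 𝔤₁`. -/
def parPos (L : GLSA) : Bool := (finrank ℂ ↥L.gpos) % 2 == 1

/-- Parity (as a `Bool`) of `dim 𝔤₋₁`. -/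
def parNeg (L : GLSA) : Bool := (finrank ℂ ↥L.gneg) % 2 == 1


/-- The parity involution of a decomposition `V = p ⊕ q`: the identity on `p` and minus the
identity on `q`. -/
def parityInvol {V : Type} [AddCommGroup V] [Module ℂ V] {p q : Submodule ℂ V}
    (h : IsCompl p q) : V →ₗ[ℂ] V :=
  LinearMap.ofIsCompl h p.subtype (-q.subtype)

section Parity

variable {V : Type} [AddCommGroup V] [Module ℂ V] {p q : Submodule ℂ V}

theorem eq_zero_of_eq_neg {v : V} (h : v = -v) : v = 0 := by
  have h2 : (2 : ℂ) • v = 0 := by rw [two_smul]; exact add_eq_zero_iff_eq_neg.2 h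
  exact (smul_eq_zero.1 h2).resolve_left two_ne_zero

theorem parityInvol_left (h : IsCompl p q) {v : V} (hv : v ∈ p) : parityInvol h v = v :=
  LinearMap.ofIsCompl_apply_left h (⟨v, hv⟩ : p)

theorem parityInvol_right (h : IsCompl p q) {v : V} (hv : v ∈ q) : parityInvol h v = -v :=
  LinearMap.ofIsCompl_apply_right h (⟨v, hv⟩ : q)

theorem exists_add_of_isCompl (h : IsCompl p q) (v : V) : ∃ a ∈ p, ∃ b ∈ q, a + b = v :=
  Submodule.mem_sup.1 (h.sup_eq_top ▸ Submodule.mem_top)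

theorem mem_left_iff_parityInvol (h : IsCompl p q) {v : V} : v ∈ p ↔ parityInvol h v = v := by
  refine ⟨parityInvol_left h, fun hv => ?_⟩
  obtain ⟨a, ha, b, hb, rfl⟩ := exists_add_of_isCompl h v
  rw [map_add, parityInvol_left h ha, parityInvol_right h hb] at hv
  have : b = 0 := by
    have h1 := add_left_cancel hv
    exact eq_zero_of_eq_neg h1.symm
  simpa [this] using ha

theorem mem_right_iff_parityInvol (h : IsCompl p q) {v : V} : v ∈ q ↔ parityInvol h v = -v := by
  refine ⟨parityInvol_right h, fun hv => ?_⟩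
  obtain ⟨a, ha, b, hb, rfl⟩ := exists_add_of_isCompl h v
  rw [map_add, parityInvol_left h ha, parityInvol_right h hb, neg_add] at hv
  have : a = 0 := eq_zero_of_eq_neg (add_right_cancel hv)
  simpa [this] using hb

theorem parityInvol_parityInvol (h : IsCompl p q) (v : V) :
    parityInvol h (parityInvol h v) = v := by
  obtain ⟨a, ha, b, hb, rfl⟩ := exists_add_of_isCompl h v
  simp [parityInvol_left h ha, parityInvol_right h hb]

/-- A subspace is graded if and only if it is stable under the parity involution. -/
theorem le_inf_sup_inf_iff (h : IsCompl p q) {N : Submodule ℂ V} :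
    N ≤ (N ⊓ p) ⊔ (N ⊓ q) ↔ ∀ v ∈ N, parityInvol h v ∈ N := by
  constructor
  · intro hN v hv
    obtain ⟨a, ha, b, hb, rfl⟩ := Submodule.mem_sup.1 (hN hv)
    rw [map_add, parityInvol_left h ha.2, parityInvol_right h hb.2]
    exact N.add_mem ha.1 (N.neg_mem hb.1)
  · intro hN v hv
    obtain ⟨a, ha, b, hb, rfl⟩ := exists_add_of_isCompl h v
    have h1 := hN _ hv
    rw [map_add, parityInvol_left h ha, parityInvol_right h hb] at h1
    refine Submodule.add_mem_sup ⟨?_, ha⟩ ⟨?_, hb⟩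
    · have h2 := N.smul_mem (1 / 2 : ℂ) (N.add_mem hv h1)
      rwa [show (1 / 2 : ℂ) • (a + b + (a + -b)) = a by module] at h2
    · have h2 := N.smul_mem (1 / 2 : ℂ) (N.sub_mem hv h1)
      rwa [show (1 / 2 : ℂ) • (a + b - (a + -b)) = b by module] at h2

/-- An involution decomposes the space into its two eigenspaces. -/
theorem isCompl_of_involution (σ : V →ₗ[ℂ] V) (h : ∀ v, σ (σ v) = v) :
    IsCompl (LinearMap.ker (σ - LinearMap.id)) (LinearMap.ker (σ + LinearMap.id)) := by
  constructor
  · rw [Submodule.disjoint_def]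
    intro v h1 h2
    simp only [LinearMap.mem_ker, LinearMap.sub_apply, LinearMap.add_apply, LinearMap.id_apply]
      at h1 h2
    rw [sub_eq_zero.1 h1] at h2
    exact eq_zero_of_eq_neg (add_eq_zero_iff_eq_neg.1 h2)
  · rw [codisjoint_iff, eq_top_iff]
    intro v _
    have : v = (1 / 2 : ℂ) • (v + σ v) + (1 / 2 : ℂ) • (v - σ v) := by module
    rw [this]
    refine Submodule.add_mem_sup (Submodule.smul_mem _ _ ?_) (Submodule.smul_mem _ _ ?_)
    · simp [h, add_comm]
    · simp [h]

end Parity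

section OddOperators

variable {M ι : Type} [AddCommGroup M] [Module ℂ M]

/-- If an operator anticommutes with each member of a list, it commutes up to a sign with the
product of the list. -/
theorem exists_sign_commute {A : Type} [Ring A] [Algebra ℂ A] (a : A) (l : List A)
    (h : ∀ b ∈ l, a * b = -(b * a)) :
    ∃ ε : ℂ, ε * ε = 1 ∧ a * l.prod = ε • (l.prod * a) := by
  induction l with
  | nil => exact ⟨1, by simp⟩
  | cons b l ih =>
    obtain ⟨ε, hsq, hε⟩ := ih fun c hc => h c (List.mem_cons_of_mem _ hc)
    refine ⟨-ε, by rwa [neg_mul_neg], ?_⟩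
    rw [List.prod_cons, ← mul_assoc, h b List.mem_cons_self, neg_mul, mul_assoc, hε,
      mul_smul_comm, neg_smul, mul_assoc]

/-- Anticommuting square-zero elements annihilate the product of any list containing them. -/
theorem mul_prod_eq_zero_of_mem {A : Type} [Ring A] (x : ι → A)
    (hx : ∀ i j, x i * x j = -(x j * x i)) (hsq : ∀ i, x i * x i = 0) {l : List ι} {i : ι}
    (hi : i ∈ l) : x i * (l.map x).prod = 0 := by
  induction l with
  | nil => simp at hi
  | cons j l ih =>
    rw [List.map_cons, List.prod_cons, ← mul_assoc]
    rcases List.mem_cons.1 hi with rfl | hi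
    · rw [hsq, zero_mul]
    · rw [hx, neg_mul, mul_assoc, ih hi, mul_zero, neg_zero]

/-- Given creation operators `x` and annihilation operators `d`, a vector killed by creation
operators lies in the image of their product. -/
theorem mem_range_prod_of_forall_eq_zero [DecidableEq ι] (x d : ι → Module.End ℂ M)
    (h : ∀ i j, d i * x j = (if i = j then 1 else 0) - x j * d i)
    {l : List ι} (hl : l.Nodup) {m : M} (hm : ∀ i ∈ l, x i m = 0) :
    ∃ m', m = (l.map x).prod m' := by
  induction l with
  | nil => exact ⟨m, rfl⟩
  | cons i l ih =>
    obtain ⟨m', hm'⟩ := ih hl.of_cons fun j hj => hm j (List.mem_cons_of_mem _ hj)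
    have hi : i ∉ l := (List.nodup_cons.1 hl).1
    obtain ⟨ε, -, hε⟩ := exists_sign_commute (d i) (l.map x) (by
      intro b hb
      obtain ⟨j, hj, rfl⟩ := List.mem_map.1 hb
      have : i ≠ j := fun e => hi (e ▸ hj)
      rw [h, if_neg this, zero_sub])
    have h1 : d i (x i m) = m - x i (d i m) := by
      simpa using LinearMap.congr_fun (h i i) m
    rw [hm i List.mem_cons_self, map_zero] at h1
    refine ⟨ε • d i m', ?_⟩
    have h2 : d i m = ε • (l.map x).prod (d i m') := by
      rw [hm']
      exact LinearMap.congr_fun hε m'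
    rw [List.map_cons, List.prod_cons, Module.End.mul_apply, map_smul, ← h2]
    exact sub_eq_zero.1 h1.symm

/-- Finitely many anticommuting square-zero operators have a common kernel vector in any non-zero
stable subspace. -/
theorem exists_ne_zero_forall_eq_zero (x : ι → Module.End ℂ M)
    (hx : ∀ i j m, x i (x j m) = -(x j (x i m))) (hsq : ∀ i m, x i (x i m) = 0)
    {N : Submodule ℂ M} (hN : ∀ i, ∀ m ∈ N, x i m ∈ N) (hne : N ≠ ⊥) (s : Finset ι) :
    ∃ m ∈ N, m ≠ 0 ∧ ∀ i ∈ s, x i m = 0 := by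
  classical
  induction s using Finset.induction_on with
  | empty =>
    obtain ⟨m, hm, h0⟩ := N.exists_mem_ne_zero_of_ne_bot hne
    exact ⟨m, hm, h0, by simp⟩
  | insert i s _ ih =>
    obtain ⟨m, hm, h0, hs⟩ := ih
    by_cases him : x i m = 0
    · refine ⟨m, hm, h0, fun j hj => ?_⟩
      rcases Finset.mem_insert.1 hj with rfl | hj
      exacts [him, hs j hj]
    · refine ⟨x i m, hN i m hm, him, fun j hj => ?_⟩
      rcases Finset.mem_insert.1 hj with rfl | hj
      · exact hsq j m
      · rw [hx, hs j hj, map_zero, neg_zero]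

end OddOperators

namespace GLSA

variable (L : GLSA)

/-- The restriction of the bracket to a pair of subspaces and a subspace containing the values. -/
def brRestrict {p q r : Submodule ℂ L.carrier} (h : ∀ x ∈ p, ∀ y ∈ q, L.bracket x y ∈ r) :
    p →ₗ[ℂ] q →ₗ[ℂ] r :=
  LinearMap.mk₂ ℂ (fun x y => ⟨L.bracket x y, h _ x.2 _ y.2⟩)
    (fun _ _ _ => Subtype.ext (by simp)) (fun _ _ _ => Subtype.ext (by simp))
    (fun _ _ _ => Subtype.ext (by simp)) (fun _ _ _ => Subtype.ext (by simp))

/-- The bracket `𝔤₀ × 𝔤₀ → 𝔤₀`. -/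
def br00 : L.g0 →ₗ[ℂ] L.g0 →ₗ[ℂ] L.g0 := L.brRestrict L.br_00

/-- The bracket `𝔤₀ × 𝔤₁ → 𝔤₁`. -/
def br0p : L.g0 →ₗ[ℂ] L.gpos →ₗ[ℂ] L.gpos := L.brRestrict L.br_0p

/-- The bracket `𝔤₀ × 𝔤₋₁ → 𝔤₋₁`. -/
def br0n : L.g0 →ₗ[ℂ] L.gneg →ₗ[ℂ] L.gneg := L.brRestrict L.br_0n

/-- The bracket `𝔤₁ × 𝔤₋₁ → 𝔤₀`. -/
def brpn : L.gpos →ₗ[ℂ] L.gneg →ₗ[ℂ] L.g0 := L.brRestrict L.br_pn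

@[simp] theorem coe_br00 (z z' : L.g0) : (L.br00 z z' : L.carrier) = L.bracket z z' := rfl

@[simp] theorem coe_br0p (z : L.g0) (x : L.gpos) : (L.br0p z x : L.carrier) = L.bracket z x := rfl

@[simp] theorem coe_br0n (z : L.g0) (y : L.gneg) : (L.br0n z y : L.carrier) = L.bracket z y := rfl

@[simp] theorem coe_brpn (x : L.gpos) (y : L.gneg) : (L.brpn x y : L.carrier) = L.bracket x y :=
  rfl

variable {L}

theorem mem_odd_of_pos {x : L.carrier} (hx : x ∈ L.gpos) : x ∈ L.gneg ⊔ L.gpos :=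
  Submodule.mem_sup_right hx

theorem mem_odd_of_neg {y : L.carrier} (hy : y ∈ L.gneg) : y ∈ L.gneg ⊔ L.gpos :=
  Submodule.mem_sup_left hy

theorem bracket_neg_pos {x y : L.carrier} (hy : y ∈ L.gneg) (hx : x ∈ L.gpos) :
    L.bracket y x = L.bracket x y :=
  L.skew_oo _ (mem_odd_of_neg hy) _ (mem_odd_of_pos hx)

theorem br0p_br00 (z z' : L.g0) (x : L.gpos) :
    L.br0p (L.br00 z z') x = L.br0p z (L.br0p z' x) - L.br0p z' (L.br0p z x) := by
  apply Subtype.ext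
  simp only [coe_br00, coe_br0p, Submodule.coe_sub]
  rw [L.jacobi_e z z' x (Or.inl z.2), add_sub_cancel_right]

theorem brpn_br0n (z : L.g0) (x : L.gpos) (y : L.gneg) :
    L.brpn x (L.br0n z y) = L.br00 z (L.brpn x y) - L.brpn (L.br0p z x) y := by
  apply Subtype.ext
  simp only [coe_br00, coe_br0p, coe_br0n, coe_brpn, Submodule.coe_sub]
  rw [L.jacobi_e z x y (Or.inl z.2), add_sub_cancel_left]

theorem br0n_brpn_add (x : L.gpos) (y y' : L.gneg) :
    L.br0n (L.brpn x y) y' + L.br0n (L.brpn x y') y = 0 := by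
  apply Subtype.ext
  simp only [coe_br0n, coe_brpn, Submodule.coe_add, ZeroMemClass.coe_zero]
  have h1 := L.jacobi_oo x (mem_odd_of_pos x.2) y (mem_odd_of_neg y.2) y'
  rw [L.br_nn _ y.2 _ y'.2, map_zero, eq_comm, sub_eq_zero] at h1
  rw [h1, L.skew_e _ (L.br_pn _ x.2 _ y'.2) y, add_neg_cancel]

theorem br0p_brpn_add (x x' : L.gpos) (y : L.gneg) :
    L.br0p (L.brpn x y) x' + L.br0p (L.brpn x' y) x = 0 := by
  apply Subtype.ext
  simp only [coe_br0p, coe_brpn, Submodule.coe_add, ZeroMemClass.coe_zero]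
  have h1 := L.jacobi_oo x (mem_odd_of_pos x.2) x' (mem_odd_of_pos x'.2) y
  rw [L.br_pp _ x.2 _ x'.2, map_zero, LinearMap.zero_apply, zero_sub] at h1
  rw [L.skew_e _ (L.br_pn _ x.2 _ y.2) x', L.skew_e _ (L.br_pn _ x'.2 _ y.2) x, h1]
  simp

theorem br0p_brpn_self (x : L.gpos) (y : L.gneg) : L.br0p (L.brpn x y) x = 0 :=
  eq_zero_of_eq_neg (add_eq_zero_iff_eq_neg.1 (br0p_brpn_add x x y))

theorem isCompl_neg : IsCompl L.gneg (L.g0 ⊔ L.gpos) := by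
  constructor
  · rw [sup_comm]
    refine Disjoint.disjoint_sup_right_of_disjoint_sup_left L.disjNP ?_
    exact L.oddCompl.disjoint.symm
  · rw [codisjoint_iff, sup_left_comm]
    exact L.oddCompl.sup_eq_top

theorem isCompl_pos : IsCompl L.gpos (L.g0 ⊔ L.gneg) := by
  constructor
  · rw [sup_comm]
    refine Disjoint.disjoint_sup_right_of_disjoint_sup_left L.disjNP.symm ?_
    rw [sup_comm]
    exact L.oddCompl.disjoint.symm
  · rw [codisjoint_iff, sup_left_comm, sup_comm L.gpos]
    exact L.oddCompl.sup_eq_top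

theorem exists_add_odd {x : L.carrier} (hx : x ∈ L.gneg ⊔ L.gpos) :
    ∃ (n : L.gneg) (p : L.gpos), x = n + p := by
  obtain ⟨n, hn, p, hp, rfl⟩ := Submodule.mem_sup.1 hx
  exact ⟨⟨n, hn⟩, ⟨p, hp⟩, rfl⟩

theorem exists_add (x : L.carrier) :
    ∃ (z : L.g0) (n : L.gneg) (p : L.gpos), x = z + (n + p) := by
  obtain ⟨z, hz, o, ho, rfl⟩ := exists_add_of_isCompl L.oddCompl x
  obtain ⟨n, p, rfl⟩ := exists_add_odd ho
  exact ⟨⟨z, hz⟩, n, p, rfl⟩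

end GLSA

open scoped TensorProduct

/-- The underlying vector space `Λ(𝔤₁) ⊗ W` of the opposite Kac module of `W`. -/
abbrev KacSpace {L : GLSA} (W : SMod0 L) : Type := ExteriorAlgebra ℂ L.gpos ⊗[ℂ] W.carrier

namespace KacSpace

open ExteriorAlgebra GLSA

variable {L : GLSA} {W : SMod0 L}

/-- The inclusion `W → Λ(𝔤₁) ⊗ W`. -/
def unit (W : SMod0 L) : W.carrier →ₗ[ℂ] KacSpace W :=
  TensorProduct.mk ℂ (ExteriorAlgebra ℂ L.gpos) W.carrier 1

theorem smul_unit (e : ExteriorAlgebra ℂ L.gpos) (w : W.carrier) : e • unit W w = e ⊗ₜ w := by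
  simp [unit, TensorProduct.smul_tmul']

theorem induction {P : KacSpace W → Prop} (unit : ∀ w, P (unit W w))
    (add : ∀ m m', P m → P m' → P (m + m'))
    (smul : ∀ (x : L.gpos) m, P m → P (ι ℂ x • m)) (m : KacSpace W) : P m := by
  have h0 : P 0 := by simpa using unit 0
  induction m using TensorProduct.induction_on with
  | zero => exact h0
  | add m m' h h' => exact add m m' h h'
  | tmul e w =>
    rw [← smul_unit]
    induction e using CliffordAlgebra.left_induction with
    | algebraMap r =>
      rw [algebraMap_smul, ← map_smul]
      exact unit _
    | add e e' h h' =>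
      rw [add_smul]
      exact add _ _ h h'
    | ι_mul e x h =>
      rw [mul_smul]
      exact smul x _ h

/-- Triples of a vector, and candidates for the action of `𝔤₀` and of `𝔤₋₁` on it. -/
abbrev Aux (W : SMod0 L) : Type :=
  KacSpace W × (L.g0 →ₗ[ℂ] KacSpace W) × (L.gneg →ₗ[ℂ] KacSpace W)

/-- The action of an element of `𝔤₁` on triples which is forced by the commutation relations. -/
def auxStepFun (x : L.gpos) (t : Aux W) : Aux W :=
  (ι ℂ x • t.1,
    { toFun := fun z => ι ℂ (L.br0p z x) • t.1 + ι ℂ x • t.2.1 z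
      map_add' := fun z z' => by simp only [map_add, LinearMap.add_apply, add_smul, smul_add]; abel
      map_smul' := fun c z => by
        simp only [map_smul, LinearMap.smul_apply, smul_assoc, smul_add, RingHom.id_apply,
          smul_comm _ c] },
    { toFun := fun y => t.2.1 (L.brpn x y) - ι ℂ x • t.2.2 y
      map_add' := fun z z' => by simp only [map_add, smul_add]; abel
      map_smul' := fun c z => by
        simp only [map_smul, smul_sub, RingHom.id_apply, smul_comm _ c] })

/-- The action of `𝔤₁` on triples which is forced by the commutation relations. -/
def auxStep (W : SMod0 L) : L.gpos →ₗ[ℂ] Module.End ℂ (Aux W) :=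
  LinearMap.mk₂ ℂ auxStepFun
    (fun x x' t => by
      refine Prod.ext ?_ (Prod.ext (LinearMap.ext fun z => ?_) (LinearMap.ext fun z => ?_))
      all_goals simp [auxStepFun, add_smul]
      all_goals abel)
    (fun c x t => by
      refine Prod.ext ?_ (Prod.ext (LinearMap.ext fun z => ?_) (LinearMap.ext fun z => ?_))
      all_goals simp [auxStepFun, smul_sub, smul_assoc])
    (fun x t t' => by
      refine Prod.ext ?_ (Prod.ext (LinearMap.ext fun z => ?_) (LinearMap.ext fun z => ?_))
      all_goals simp [auxStepFun]
      all_goals abel)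
    (fun c x t => by
      refine Prod.ext ?_ (Prod.ext (LinearMap.ext fun z => ?_) (LinearMap.ext fun z => ?_))
      all_goals simp [auxStepFun, smul_sub, smul_comm _ c])

theorem ι_smul_ι_smul_self (x : L.gpos) (m : KacSpace W) : ι ℂ x • ι ℂ x • m = 0 := by
  rw [smul_smul, ι_sq_zero, zero_smul]

theorem ι_smul_ι_smul (x x' : L.gpos) (m : KacSpace W) :
    ι ℂ x • ι ℂ x' • m = -(ι ℂ x' • ι ℂ x • m) := by
  rw [eq_neg_iff_add_eq_zero, smul_smul, smul_smul, ← add_smul, ι_add_mul_swap, zero_smul]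

theorem auxStep_mul_self (x : L.gpos) : auxStep W x * auxStep W x = 0 := by
  refine LinearMap.ext fun t =>
    Prod.ext ?_ (Prod.ext (LinearMap.ext fun z => ?_) (LinearMap.ext fun y => ?_))
  · exact ι_smul_ι_smul_self x t.1
  · change ι ℂ (L.br0p z x) • ι ℂ x • t.1 + ι ℂ x • (ι ℂ (L.br0p z x) • t.1 + ι ℂ x • t.2.1 z) = 0
    rw [smul_add, ι_smul_ι_smul_self, add_zero, ι_smul_ι_smul, neg_add_cancel]
  · change ι ℂ (L.br0p (L.brpn x y) x) • t.1 + ι ℂ x • t.2.1 (L.brpn x y) -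
      ι ℂ x • (t.2.1 (L.brpn x y) - ι ℂ x • t.2.2 y) = 0
    rw [smul_sub, ι_smul_ι_smul_self, br0p_brpn_self, map_zero, zero_smul]
    abel

/-- The action of `Λ(𝔤₁)` on triples. -/
def auxHom (W : SMod0 L) : ExteriorAlgebra ℂ L.gpos →ₐ[ℂ] Module.End ℂ (Aux W) :=
  ExteriorAlgebra.lift ℂ ⟨auxStep W, auxStep_mul_self⟩

/-- The triples attached to vectors of `W`. -/
def auxUnit (W : SMod0 L) : W.carrier →ₗ[ℂ] Aux W :=
  (unit W).prod (((LinearMap.compRight ℂ (unit W)).comp W.act.flip).prod 0)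

/-- The triple attached to a vector of `Λ(𝔤₁) ⊗ W`. -/
def auxTotal (W : SMod0 L) : KacSpace W →ₗ[ℂ] Aux W :=
  TensorProduct.lift ((LinearMap.lcomp ℂ (Aux W) (auxUnit W)).comp (auxHom W).toLinearMap)

theorem auxTotal_unit (w : W.carrier) : auxTotal W (unit W w) = auxUnit W w := by
  simp [auxTotal, unit]

theorem auxTotal_smul (x : L.gpos) (m : KacSpace W) :
    auxTotal W (ι ℂ x • m) = auxStep W x (auxTotal W m) := by
  induction m using TensorProduct.induction_on with
  | zero => simp
  | add m m' h h' => rw [smul_add, map_add, h, h', map_add, map_add]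
  | tmul e w => simp [auxTotal, TensorProduct.smul_tmul', auxHom]

theorem auxTotal_fst (m : KacSpace W) : (auxTotal W m).1 = m := by
  induction m using KacSpace.induction with
  | unit w => rw [auxTotal_unit]; rfl
  | add m m' h h' => rw [map_add, Prod.fst_add, h, h']
  | smul x m h =>
    rw [auxTotal_smul]
    change ι ℂ x • (auxTotal W m).1 = _
    rw [h]

/-- The action of `𝔤₀` on `Λ(𝔤₁) ⊗ W`. -/
def act0 (W : SMod0 L) : L.g0 →ₗ[ℂ] Module.End ℂ (KacSpace W) :=
  (LinearMap.fst ℂ _ _ ∘ₗ LinearMap.snd ℂ _ _ ∘ₗ auxTotal W).flip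

/-- The action of `𝔤₋₁` on `Λ(𝔤₁) ⊗ W`. -/
def actNeg (W : SMod0 L) : L.gneg →ₗ[ℂ] Module.End ℂ (KacSpace W) :=
  (LinearMap.snd ℂ _ _ ∘ₗ LinearMap.snd ℂ _ _ ∘ₗ auxTotal W).flip

/-- The action of `𝔤₁` on `Λ(𝔤₁) ⊗ W`. -/
def actPos (W : SMod0 L) : L.gpos →ₗ[ℂ] Module.End ℂ (KacSpace W) :=
  (Algebra.lsmul ℂ ℂ (KacSpace W)).toLinearMap ∘ₗ ι ℂ

theorem actPos_apply (x : L.gpos) (m : KacSpace W) : actPos W x m = ι ℂ x • m := rfl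

theorem ι_sub_smul (x x' : L.gpos) (m : KacSpace W) :
    ι ℂ (x - x') • m = ι ℂ x • m - ι ℂ x' • m := by
  rw [← actPos_apply, map_sub]
  rfl

theorem act0_unit (z : L.g0) (w : W.carrier) : act0 W z (unit W w) = unit W (W.act z w) := by
  change (auxTotal W (unit W w)).2.1 z = _
  rw [auxTotal_unit]
  rfl

theorem act0_smul (z : L.g0) (x : L.gpos) (m : KacSpace W) :
    act0 W z (ι ℂ x • m) = ι ℂ (L.br0p z x) • m + ι ℂ x • act0 W z m := by
  change (auxTotal W (ι ℂ x • m)).2.1 z = _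
  rw [auxTotal_smul]
  change ι ℂ (L.br0p z x) • (auxTotal W m).1 + _ = _
  rw [auxTotal_fst]
  rfl

theorem actNeg_unit (y : L.gneg) (w : W.carrier) : actNeg W y (unit W w) = 0 := by
  change (auxTotal W (unit W w)).2.2 y = _
  rw [auxTotal_unit]
  rfl

theorem actNeg_smul (y : L.gneg) (x : L.gpos) (m : KacSpace W) :
    actNeg W y (ι ℂ x • m) = act0 W (L.brpn x y) m - ι ℂ x • actNeg W y m := by
  change (auxTotal W (ι ℂ x • m)).2.2 y = _
  rw [auxTotal_smul]
  rfl

theorem act0_br00 (z z' : L.g0) (m : KacSpace W) :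
    act0 W (L.br00 z z') m = act0 W z (act0 W z' m) - act0 W z' (act0 W z m) := by
  induction m using KacSpace.induction with
  | unit w =>
    simp only [act0_unit, ← map_sub]
    exact congrArg _ (W.act_br z z' w)
  | add m m' h h' => simp only [map_add, h, h']; abel
  | smul x m h =>
    simp only [act0_smul, map_add, h, br0p_br00, ι_sub_smul, smul_sub]
    abel

theorem actNeg_br0n (z : L.g0) (y : L.gneg) (m : KacSpace W) :
    actNeg W (L.br0n z y) m = act0 W z (actNeg W y m) - actNeg W y (act0 W z m) := by
  induction m using KacSpace.induction with
  | unit w => simp only [act0_unit, actNeg_unit, map_zero, sub_zero]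
  | add m m' h h' => simp only [map_add, h, h']; abel
  | smul x m h =>
    simp only [act0_smul, actNeg_smul, map_add, h, brpn_br0n, map_sub, LinearMap.sub_apply,
      act0_br00, smul_sub]
    abel

theorem actNeg_actNeg (y y' : L.gneg) (m : KacSpace W) :
    actNeg W y (actNeg W y' m) + actNeg W y' (actNeg W y m) = 0 := by
  induction m using KacSpace.induction with
  | unit w => simp only [actNeg_unit, map_zero, add_zero]
  | add m m' h h' =>
    simp only [map_add]
    rw [add_add_add_comm, h, h', add_zero]
  | smul x m h =>
    have h1 := actNeg_br0n (L.brpn x y) y' m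
    have h2 := actNeg_br0n (L.brpn x y') y m
    have h3 := congrArg (fun u => actNeg W u m) (br0n_brpn_add x y y')
    simp only [map_add, LinearMap.add_apply, map_zero, LinearMap.zero_apply] at h3
    have h4 : ι ℂ x • actNeg W y (actNeg W y' m) + ι ℂ x • actNeg W y' (actNeg W y m) = 0 := by
      rw [← smul_add, h, smul_zero]
    simp only [actNeg_smul, map_sub]
    rw [h1, h2] at h3
    rw [← h4, ← sub_eq_zero, ← neg_eq_zero, ← h3]
    abel

/-- The parity operator on `Λ(𝔤₁) ⊗ W`. -/
def parity (W : SMod0 L) : KacSpace W →ₗ[ℂ] KacSpace W :=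
  TensorProduct.map CliffordAlgebra.involute.toLinearMap (parityInvol W.grading)

theorem parity_unit (w : W.carrier) : parity W (unit W w) = unit W (parityInvol W.grading w) := by
  simp [parity, unit]

theorem parity_smul_smul (e : ExteriorAlgebra ℂ L.gpos) (m : KacSpace W) :
    parity W (e • m) = CliffordAlgebra.involute e • parity W m := by
  induction m using TensorProduct.induction_on with
  | zero => simp
  | add m m' h h' => rw [smul_add, map_add, h, h', map_add, smul_add]
  | tmul e w => simp [parity, TensorProduct.smul_tmul']

theorem parity_smul (x : L.gpos) (m : KacSpace W) :
    parity W (ι ℂ x • m) = -(ι ℂ x • parity W m) := by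
  rw [parity_smul_smul, show CliffordAlgebra.involute (ι ℂ x) = -ι ℂ x from
    CliffordAlgebra.involute_ι x]
  exact neg_smul (R := ExteriorAlgebra ℂ L.gpos) _ (parity W m)

theorem parity_parity (m : KacSpace W) : parity W (parity W m) = m := by
  induction m using KacSpace.induction with
  | unit w => rw [parity_unit, parity_unit, parityInvol_parityInvol]
  | add m m' h h' => rw [map_add, map_add, h, h']
  | smul x m h => rw [parity_smul, map_neg, parity_smul, h, neg_neg]

end KacSpace
namespace KacSpace

open ExteriorAlgebra GLSA

variable {L : GLSA} {W : SMod0 L}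

theorem parity_act0 (z : L.g0) (m : KacSpace W) :
    parity W (act0 W z m) = act0 W z (parity W m) := by
  induction m using KacSpace.induction with
  | unit w =>
    rw [act0_unit, parity_unit, parity_unit, act0_unit]
    congr 1
    obtain ⟨a, ha, b, hb, rfl⟩ := exists_add_of_isCompl W.grading w
    simp only [map_add, parityInvol_left W.grading ha, parityInvol_right W.grading hb,
      parityInvol_left W.grading (W.act_ev z a ha), parityInvol_right W.grading (W.act_od z b hb),
      map_neg]
  | add m m' h h' => simp only [map_add, h, h']
  | smul x m h => simp only [act0_smul, map_add, parity_smul, h, map_neg]; abel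

theorem parity_actNeg (y : L.gneg) (m : KacSpace W) :
    parity W (actNeg W y m) = -actNeg W y (parity W m) := by
  induction m using KacSpace.induction with
  | unit w => simp only [parity_unit, actNeg_unit, map_zero, neg_zero]
  | add m m' h h' => simp only [map_add, h, h']; abel
  | smul x m h =>
    simp only [actNeg_smul, map_sub, parity_smul, h, map_neg, parity_act0, smul_neg, sub_neg_eq_add]
    abel

theorem parity_actPos (x : L.gpos) (m : KacSpace W) :
    parity W (actPos W x m) = -actPos W x (parity W m) :=
  parity_smul x m

/-- The action of `𝔤` on `Λ(𝔤₁) ⊗ W`. -/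
def act (W : SMod0 L) : L.carrier →ₗ[ℂ] Module.End ℂ (KacSpace W) :=
  act0 W ∘ₗ Submodule.projectionOnto _ _ L.oddCompl +
    actNeg W ∘ₗ Submodule.projectionOnto _ _ (isCompl_neg (L := L)) +
    actPos W ∘ₗ Submodule.projectionOnto _ _ (isCompl_pos (L := L))

theorem act_coe_g0 (z : L.g0) : act W z = act0 W z := by
  simp only [act, LinearMap.add_apply, LinearMap.comp_apply]
  rw [Submodule.projectionOnto_apply_left,
    (Submodule.projectionOnto_apply_eq_zero_iff _).2 (Submodule.mem_sup_left z.2),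
    (Submodule.projectionOnto_apply_eq_zero_iff _).2 (Submodule.mem_sup_left z.2), map_zero,
    map_zero, add_zero, add_zero]

theorem act_coe_neg (y : L.gneg) : act W y = actNeg W y := by
  simp only [act, LinearMap.add_apply, LinearMap.comp_apply]
  rw [Submodule.projectionOnto_apply_left,
    (Submodule.projectionOnto_apply_eq_zero_iff _).2 (Submodule.mem_sup_left y.2),
    (Submodule.projectionOnto_apply_eq_zero_iff _).2 (Submodule.mem_sup_right y.2), map_zero,
    map_zero, add_zero, zero_add]

theorem act_coe_pos (x : L.gpos) : act W x = actPos W x := by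
  simp only [act, LinearMap.add_apply, LinearMap.comp_apply]
  rw [Submodule.projectionOnto_apply_left,
    (Submodule.projectionOnto_apply_eq_zero_iff _).2 (Submodule.mem_sup_right x.2),
    (Submodule.projectionOnto_apply_eq_zero_iff _).2 (Submodule.mem_sup_right x.2), map_zero,
    map_zero, zero_add, zero_add]

theorem parity_act_even {z : L.carrier} (hz : z ∈ L.g0) (m : KacSpace W) :
    parity W (act W z m) = act W z (parity W m) := by
  rw [act_coe_g0 ⟨z, hz⟩, parity_act0]

theorem parity_act_odd {x : L.carrier} (hx : x ∈ L.odd) (m : KacSpace W) :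
    parity W (act W x m) = -act W x (parity W m) := by
  obtain ⟨n, p, rfl⟩ := exists_add_odd hx
  simp only [map_add, LinearMap.add_apply, act_coe_neg, act_coe_pos, parity_actNeg, parity_actPos]
  abel

theorem act_bracket_even {z : L.carrier} (hz : z ∈ L.g0) (x : L.carrier) (m : KacSpace W) :
    act W (L.bracket z x) m = act W z (act W x m) - act W x (act W z m) := by
  obtain ⟨z', n, p, rfl⟩ := exists_add x
  lift z to L.g0 using hz
  simp only [map_add, LinearMap.add_apply]
  rw [← coe_br00, ← coe_br0n, ← coe_br0p]
  simp only [act_coe_g0, act_coe_neg, act_coe_pos, act0_br00, actNeg_br0n, actPos_apply, act0_smul]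
  abel

theorem act_bracket_neg_neg (y y' : L.gneg) (m : KacSpace W) :
    act W (L.bracket y y') m = act W y (act W y' m) + act W y' (act W y m) := by
  rw [L.br_nn _ y.2 _ y'.2, map_zero, act_coe_neg, act_coe_neg, actNeg_actNeg]
  rfl

theorem act_bracket_pos_pos (x x' : L.gpos) (m : KacSpace W) :
    act W (L.bracket x x') m = act W x (act W x' m) + act W x' (act W x m) := by
  rw [L.br_pp _ x.2 _ x'.2, map_zero, act_coe_pos, act_coe_pos]
  simp only [actPos_apply]
  rw [ι_smul_ι_smul, neg_add_cancel]
  rfl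

theorem act_bracket_pos_neg (x : L.gpos) (y : L.gneg) (m : KacSpace W) :
    act W (L.bracket x y) m = act W x (act W y m) + act W y (act W x m) := by
  rw [← coe_brpn, act_coe_pos, act_coe_neg, act_coe_g0]
  simp only [actPos_apply, actNeg_smul]
  abel

theorem act_bracket_odd {x y : L.carrier} (hx : x ∈ L.odd) (hy : y ∈ L.odd) (m : KacSpace W) :
    act W (L.bracket x y) m = act W x (act W y m) + act W y (act W x m) := by
  obtain ⟨n, p, rfl⟩ := exists_add_odd hx
  obtain ⟨n', p', rfl⟩ := exists_add_odd hy
  simp only [map_add, LinearMap.add_apply, act_bracket_neg_neg, act_bracket_pos_pos,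
    act_bracket_pos_neg, bracket_neg_pos n.2 p'.2]
  abel

/-- The `𝔤`-supermodule structure on `Λ(𝔤₁) ⊗ W`. -/
def toSMod (W : SMod0 L) : SMod L where
  carrier := KacSpace W
  act := act W
  ev := LinearMap.ker (parity W - LinearMap.id)
  od := LinearMap.ker (parity W + LinearMap.id)
  grading := isCompl_of_involution _ parity_parity
  act_e_ev := fun z hz m hm => by
    simp only [LinearMap.mem_ker, LinearMap.sub_apply, LinearMap.id_apply, sub_eq_zero] at hm ⊢
    rw [parity_act_even hz, hm]
  act_e_od := fun z hz m hm => by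
    simp only [LinearMap.mem_ker, LinearMap.add_apply, LinearMap.id_apply,
      add_eq_zero_iff_eq_neg] at hm ⊢
    rw [parity_act_even hz, hm, map_neg]
  act_o_ev := fun z hz m hm => by
    simp only [LinearMap.mem_ker, LinearMap.sub_apply, LinearMap.add_apply, LinearMap.id_apply,
      sub_eq_zero, add_eq_zero_iff_eq_neg] at hm ⊢
    rw [parity_act_odd hz, hm]
  act_o_od := fun z hz m hm => by
    simp only [LinearMap.mem_ker, LinearMap.sub_apply, LinearMap.add_apply, LinearMap.id_apply,
      sub_eq_zero, add_eq_zero_iff_eq_neg] at hm ⊢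
    rw [parity_act_odd hz, hm, map_neg, neg_neg]
  act_br_e := fun x y hxy m => by
    rcases hxy with hx | hy
    · exact act_bracket_even hx y m
    · have h := act_bracket_even hy x m
      rw [L.skew_e y hy x, map_neg, LinearMap.neg_apply, neg_eq_iff_eq_neg, neg_sub] at h
      exact h
  act_br_oo := fun x hx y hy m => act_bracket_odd hx hy m

end KacSpace

namespace SMod

variable {L : GLSA} {M N : SMod L}

theorem parityInvol_act_odd {x : L.carrier} (hx : x ∈ L.odd) (m : M.carrier) :
    parityInvol M.grading (M.act x m) = -M.act x (parityInvol M.grading m) := by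
  obtain ⟨a, ha, b, hb, rfl⟩ := exists_add_of_isCompl M.grading m
  simp only [map_add, parityInvol_left M.grading ha, parityInvol_right M.grading hb, map_neg,
    parityInvol_right M.grading (M.act_o_ev x hx a ha),
    parityInvol_left M.grading (M.act_o_od x hx b hb), neg_add, neg_neg]

theorem act_pos_act_pos (x x' : L.gpos) (m : M.carrier) :
    M.act x (M.act x' m) = -M.act x' (M.act x m) := by
  have h := M.act_br_oo x (GLSA.mem_odd_of_pos x.2) x' (GLSA.mem_odd_of_pos x'.2) m
  rw [L.br_pp _ x.2 _ x'.2, map_zero, LinearMap.zero_apply] at h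
  exact eq_neg_of_add_eq_zero_left h.symm

theorem act_pos_act_self (x : L.gpos) (m : M.carrier) : M.act x (M.act x m) = 0 :=
  eq_zero_of_eq_neg (act_pos_act_pos x x m)

theorem act_neg_act_pos (x : L.gpos) (y : L.gneg) (m : M.carrier) :
    M.act y (M.act x m) = M.act (L.brpn x y) m - M.act x (M.act y m) := by
  rw [GLSA.coe_brpn, M.act_br_oo x (GLSA.mem_odd_of_pos x.2) y (GLSA.mem_odd_of_neg y.2)]
  abel

theorem act_g0_act_pos (z : L.g0) (x : L.gpos) (m : M.carrier) :
    M.act z (M.act x m) = M.act (L.br0p z x) m + M.act x (M.act z m) := by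
  rw [GLSA.coe_br0p, M.act_br_e z x (Or.inl z.2)]
  abel

theorem isSubmod_iff {S : Submodule ℂ M.carrier} :
    M.IsSubmod S ↔ (∀ (x : L.carrier), ∀ m ∈ S, M.act x m ∈ S) ∧
      ∀ m ∈ S, parityInvol M.grading m ∈ S := by
  rw [IsSubmod, le_inf_sup_inf_iff M.grading]

end SMod

namespace SHom

variable {L : GLSA} {M N : SMod L}

theorem parityInvol_comm (f : SHom M N) (m : M.carrier) :
    f.toLin (parityInvol M.grading m) = parityInvol N.grading (f.toLin m) := by
  obtain ⟨a, ha, b, hb, rfl⟩ := exists_add_of_isCompl M.grading m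
  simp only [map_add, parityInvol_left M.grading ha, parityInvol_right M.grading hb, map_neg,
    parityInvol_left N.grading (f.map_ev a ha), parityInvol_right N.grading (f.map_od b hb)]

theorem isSubmod_map (f : SHom M N) {S : Submodule ℂ M.carrier} (hS : M.IsSubmod S) :
    N.IsSubmod (S.map f.toLin) := by
  rw [SMod.isSubmod_iff] at hS ⊢
  constructor
  · rintro x _ ⟨m, hm, rfl⟩
    exact ⟨M.act x m, hS.1 x m hm, f.equivar x m⟩
  · rintro _ ⟨m, hm, rfl⟩
    exact ⟨_, hS.2 m hm, f.parityInvol_comm m⟩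

theorem isSubmod_comap (f : SHom M N) {S : Submodule ℂ N.carrier} (hS : N.IsSubmod S) :
    M.IsSubmod (S.comap f.toLin) := by
  rw [SMod.isSubmod_iff] at hS ⊢
  constructor
  · intro x m hm
    rw [Submodule.mem_comap, f.equivar]
    exact hS.1 x _ hm
  · intro m hm
    rw [Submodule.mem_comap, f.parityInvol_comm]
    exact hS.2 _ hm

theorem isSubmod_range (f : SHom M N) : N.IsSubmod (LinearMap.range f.toLin) := by
  rw [LinearMap.range_eq_map]
  exact f.isSubmod_map ⟨fun _ _ _ => Submodule.mem_top, by simp [M.grading.sup_eq_top]⟩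

/-- Composition of homomorphisms of supermodules. -/
def comp {P : SMod L} (g : SHom N P) (f : SHom M N) : SHom M P where
  toLin := g.toLin ∘ₗ f.toLin
  map_ev := fun m hm => g.map_ev _ (f.map_ev m hm)
  map_od := fun m hm => g.map_od _ (f.map_od m hm)
  equivar := fun x m => by simp [f.equivar, g.equivar]

/-- The identity homomorphism. -/
def id (M : SMod L) : SHom M M where
  toLin := LinearMap.id
  map_ev := fun _ hm => hm
  map_od := fun _ hm => hm
  equivar := fun _ _ => rfl

end SHom

section TopProduct

open ExteriorAlgebra

variable {V U : Type} [AddCommGroup V] [Module ℂ V] [AddCommGroup U] [Module ℂ U] {n : ℕ}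
  (b : Basis (Fin n) ℂ V)

/-- The product of the members of a basis in the exterior algebra. -/
def topProd : ExteriorAlgebra ℂ V := ((List.finRange n).map fun i => ι ℂ (b i)).prod

theorem ι_mul_ι_eq_neg (v v' : V) : ι ℂ v * ι ℂ v' = -(ι ℂ v' * ι ℂ v) :=
  eq_neg_of_add_eq_zero_left (ι_add_mul_swap v v')

theorem ι_mul_topProd (v : V) : ι ℂ v * topProd b = 0 := by
  rw [← b.sum_repr v, map_sum, Finset.sum_mul]
  refine Finset.sum_eq_zero fun i _ => ?_
  rw [map_smul, smul_mul_assoc, topProd,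
    mul_prod_eq_zero_of_mem (fun i => ι ℂ (b i)) (fun _ _ => ι_mul_ι_eq_neg _ _)
      (fun _ => ι_sq_zero _) (List.mem_finRange i), smul_zero]

theorem topProd_mul_ι (v : V) : topProd b * ι ℂ v = 0 := by
  obtain ⟨ε, hsq, hε⟩ := exists_sign_commute (ι ℂ v) ((List.finRange n).map fun i => ι ℂ (b i)) (by
    intro c hc
    obtain ⟨i, -, rfl⟩ := List.mem_map.1 hc
    exact ι_mul_ι_eq_neg _ _)
  have h : topProd b * ι ℂ v = ε • (ι ℂ v * topProd b) := by
    rw [topProd, hε, smul_smul, hsq, one_smul]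
  rw [h, ι_mul_topProd, smul_zero]

theorem exists_sign_involute_topProd :
    ∃ ε : ℂ, topProd b = ε • CliffordAlgebra.involute (topProd b) := by
  unfold topProd
  induction List.finRange n with
  | nil => exact ⟨1, by simp⟩
  | cons i l ih =>
    obtain ⟨ε, hε⟩ := ih
    refine ⟨-ε, ?_⟩
    rw [List.map_cons, List.prod_cons, map_mul,
      show CliffordAlgebra.involute (ι ℂ (b i)) = -ι ℂ (b i) from CliffordAlgebra.involute_ι _,
      neg_mul, smul_neg, neg_smul, neg_neg, ← mul_smul_comm, ← hε]

theorem contractLeft_mul_ι (i j : Fin n) (e : ExteriorAlgebra ℂ V) :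
    CliffordAlgebra.contractLeft (b.coord i) (ι ℂ (b j) * e) =
      (if i = j then e else 0) - ι ℂ (b j) * CliffordAlgebra.contractLeft (b.coord i) e := by
  refine (CliffordAlgebra.contractLeft_ι_mul _ _ _).trans ?_
  congr 1
  simp [Finsupp.single_apply, eq_comm]

/-- Elements of the exterior algebra annihilated by all vectors are top-dimensional. -/
theorem exists_eq_smul_topProd {e : ExteriorAlgebra ℂ V} (he : ∀ v, ι ℂ v * e = 0) :
    ∃ c : ℂ, e = c • topProd b := by
  obtain ⟨e', he'⟩ := mem_range_prod_of_forall_eq_zero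
    (fun i => Algebra.lmul ℂ (ExteriorAlgebra ℂ V) (ι ℂ (b i)))
    (fun i => CliffordAlgebra.contractLeft (b.coord i))
    (fun i j => by
      refine LinearMap.ext fun e => (contractLeft_mul_ι b i j e).trans ?_
      split_ifs <;> rfl)
    (List.nodup_finRange n) (fun i _ => he (b i))
  rw [show (fun i => Algebra.lmul ℂ (ExteriorAlgebra ℂ V) (ι ℂ (b i))) =
    (Algebra.lmul ℂ (ExteriorAlgebra ℂ V)) ∘ fun i => ι ℂ (b i) from rfl, ← List.map_map,
    ← map_list_prod] at he'
  change e = topProd b * e' at he'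
  rw [he']
  clear he' he
  induction e' using CliffordAlgebra.left_induction with
  | algebraMap r => exact ⟨r, by rw [← Algebra.commutes, Algebra.smul_def]⟩
  | add x y hx hy =>
    obtain ⟨c, hc⟩ := hx
    obtain ⟨d, hd⟩ := hy
    exact ⟨c + d, by rw [mul_add, hc, hd, add_smul]⟩
  | ι_mul x v _ =>
    refine ⟨0, ?_⟩
    rw [← mul_assoc, zero_smul]
    exact (congrArg (· * x) (topProd_mul_ι b v)).trans (zero_mul x)

theorem exists_eq_topProd_smul {m : ExteriorAlgebra ℂ V ⊗[ℂ] U}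
    (hm : ∀ v : V, ι ℂ v • m = 0) : ∃ m', m = topProd b • m' := by
  obtain ⟨m', hm'⟩ := mem_range_prod_of_forall_eq_zero
    (fun i => Algebra.lsmul ℂ ℂ (ExteriorAlgebra ℂ V ⊗[ℂ] U) (ι ℂ (b i)))
    (fun i => LinearMap.rTensor U (CliffordAlgebra.contractLeft (b.coord i)))
    (fun i j => by
      refine TensorProduct.ext' fun e w => ?_
      have h := congrArg (fun u => u ⊗ₜ[ℂ] w) (contractLeft_mul_ι b i j e)
      rw [TensorProduct.sub_tmul] at h
      refine Eq.trans ?_ (h.trans ?_)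
      · rfl
      · split_ifs
        · rfl
        · rw [TensorProduct.zero_tmul]; rfl)
    (List.nodup_finRange n) (fun i _ => hm (b i))
  refine ⟨m', ?_⟩
  rw [show (fun i => Algebra.lsmul ℂ ℂ (ExteriorAlgebra ℂ V ⊗[ℂ] U) (ι ℂ (b i))) =
    (Algebra.lsmul ℂ ℂ (ExteriorAlgebra ℂ V ⊗[ℂ] U)) ∘ fun i => ι ℂ (b i) from rfl,
    ← List.map_map, ← map_list_prod] at hm'
  exact hm'

end TopProduct

namespace KacSpace

open ExteriorAlgebra GLSA

variable {L : GLSA} {W : SMod0 L}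

theorem eq_zero_of_smul_unit {w : W.carrier} (hw : w ≠ 0) {e : ExteriorAlgebra ℂ L.gpos}
    (h : e • unit W w = 0) : e = 0 := by
  obtain ⟨f, hf⟩ : ∃ f : Module.Dual ℂ W.carrier, f w ≠ 0 := by
    by_contra! h
    exact hw ((Module.forall_dual_apply_eq_zero_iff ℂ w).1 h)
  have h1 := congrArg ((TensorProduct.rid ℂ _).toLinearMap ∘ₗ LinearMap.lTensor _ f) ((smul_unit e w).symm.trans h)
  simpa [hf] using h1

theorem act0_smul_smul (z : L.g0) (e : ExteriorAlgebra ℂ L.gpos) :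
    ∃ u : ExteriorAlgebra ℂ L.gpos, ∀ m : KacSpace W,
      act0 W z (e • m) = u • m + e • act0 W z m := by
  induction e using CliffordAlgebra.left_induction with
  | algebraMap r => exact ⟨0, fun m => by rw [algebraMap_smul, algebraMap_smul, map_smul]; simp⟩
  | add e e' h h' =>
    obtain ⟨u, hu⟩ := h
    obtain ⟨u', hu'⟩ := h'
    refine ⟨u + u', fun m => ?_⟩
    rw [add_smul, map_add, hu, hu', add_smul, add_smul]
    abel
  | ι_mul e x h =>
    obtain ⟨u, hu⟩ := h
    refine ⟨ι ℂ (L.br0p z x) * e + ι ℂ x * u, fun m => ?_⟩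
    have h1 (a b : ExteriorAlgebra ℂ L.gpos) (m : KacSpace W) : (a * b) • m = a • b • m :=
      mul_smul a b m
    change act0 W z ((ι ℂ x * e) • m) = _ + (ι ℂ x * e) • act0 W z m
    rw [h1, act0_smul, hu, smul_add, add_smul, h1, h1, h1, add_assoc]

/-- `𝔤₀` acts on the top exterior power of `𝔤₁` by a character. -/
theorem act0_topProd_smul {n : ℕ} (b : Basis (Fin n) ℂ L.gpos) (z : L.g0) :
    ∃ c : ℂ, ∀ m : KacSpace W,
      act0 W z (topProd b • m) = c • topProd b • m + topProd b • act0 W z m := by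
  obtain ⟨u, hu⟩ := act0_smul_smul (W := W) z (topProd b)
  rcases subsingleton_or_nontrivial W.carrier with hW | hW
  · have : Subsingleton (KacSpace W) := inferInstance
    exact ⟨0, fun m => Subsingleton.elim _ _⟩
  obtain ⟨w, hw⟩ := exists_ne (0 : W.carrier)
  have hι : ∀ x : L.gpos, ι ℂ x * u = 0 := by
    intro x
    have h1 := act0_smul z x (topProd b • unit W w)
    rw [hu, smul_add] at h1
    simp only [smul_smul, ι_mul_topProd, zero_smul, map_zero, zero_add, add_zero] at h1
    exact eq_zero_of_smul_unit hw h1.symm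
  obtain ⟨c, rfl⟩ := exists_eq_smul_topProd b hι
  exact ⟨c, fun m => by rw [hu, smul_assoc]⟩

theorem topProd_smul_mem {n : ℕ} (b : Basis (Fin n) ℂ L.gpos) (m : KacSpace W) :
    ∃ w, topProd b • m = topProd b • unit W w := by
  induction m using KacSpace.induction with
  | unit w => exact ⟨w, rfl⟩
  | add m m' h h' =>
    obtain ⟨w, hw⟩ := h
    obtain ⟨w', hw'⟩ := h'
    exact ⟨w + w', by rw [smul_add, hw, hw', map_add, smul_add]⟩
  | smul x m _ => exact ⟨0, by rw [smul_smul, topProd_mul_ι, zero_smul, map_zero, smul_zero]⟩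

/-- The action of `Λ(𝔤₁)` on a `𝔤`-supermodule. -/
def posHom (M : SMod L) : ExteriorAlgebra ℂ L.gpos →ₐ[ℂ] Module.End ℂ M.carrier :=
  ExteriorAlgebra.lift ℂ ⟨M.act ∘ₗ L.gpos.subtype, fun x => LinearMap.ext (M.act_pos_act_self x)⟩

/-- The extension of a linear map `W → M` to `Λ(𝔤₁) ⊗ W`. -/
def extend (M : SMod L) (φ : W.carrier →ₗ[ℂ] M.carrier) : KacSpace W →ₗ[ℂ] M.carrier :=
  TensorProduct.lift ((LinearMap.lcomp ℂ M.carrier φ).comp (posHom M).toLinearMap)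

variable {M : SMod L} {φ : W.carrier →ₗ[ℂ] M.carrier}

theorem extend_unit (w : W.carrier) : extend M φ (unit W w) = φ w := by
  simp [extend, unit]

theorem extend_smul (x : L.gpos) (m : KacSpace W) :
    extend M φ (ι ℂ x • m) = M.act x (extend M φ m) := by
  induction m using TensorProduct.induction_on with
  | zero => simp
  | add m m' h h' => rw [smul_add, map_add, h, h', map_add, map_add]
  | tmul e w => simp [extend, TensorProduct.smul_tmul', posHom]

theorem extend_act0 (hφ : ∀ (z : L.g0) w, φ (W.act z w) = M.act z (φ w)) (z : L.g0)
    (m : KacSpace W) : extend M φ (act0 W z m) = M.act z (extend M φ m) := by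
  induction m using KacSpace.induction with
  | unit w => rw [act0_unit, extend_unit, extend_unit, hφ]
  | add m m' h h' => simp only [map_add, h, h']
  | smul x m h => rw [act0_smul, map_add, extend_smul, extend_smul, extend_smul, h,
      M.act_g0_act_pos]

theorem extend_actNeg (hφ : ∀ (z : L.g0) w, φ (W.act z w) = M.act z (φ w))
    (hn : ∀ y ∈ L.gneg, ∀ w, M.act y (φ w) = 0) (y : L.gneg) (m : KacSpace W) :
    extend M φ (actNeg W y m) = M.act y (extend M φ m) := by
  induction m using KacSpace.induction with
  | unit w => rw [actNeg_unit, extend_unit, hn y y.2, map_zero]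
  | add m m' h h' => simp only [map_add, h, h']
  | smul x m h => rw [actNeg_smul, map_sub, extend_smul, extend_smul, h, extend_act0 hφ,
      M.act_neg_act_pos]

theorem extend_parity (hev : ∀ w ∈ W.ev, φ w ∈ M.ev) (hod : ∀ w ∈ W.od, φ w ∈ M.od)
    (m : KacSpace W) : extend M φ (parity W m) = parityInvol M.grading (extend M φ m) := by
  induction m using KacSpace.induction with
  | unit w =>
    rw [parity_unit, extend_unit, extend_unit]
    obtain ⟨a, ha, b, hb, rfl⟩ := exists_add_of_isCompl W.grading w
    simp only [map_add, parityInvol_left W.grading ha, parityInvol_right W.grading hb, map_neg,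
      parityInvol_left M.grading (hev a ha), parityInvol_right M.grading (hod b hb)]
  | add m m' h h' => simp only [map_add, h, h']
  | smul x m h =>
    rw [parity_smul, map_neg, extend_smul, extend_smul, h,
      M.parityInvol_act_odd (GLSA.mem_odd_of_pos x.2)]

theorem extend_act (hφ : ∀ (z : L.g0) w, φ (W.act z w) = M.act z (φ w))
    (hn : ∀ y ∈ L.gneg, ∀ w, M.act y (φ w) = 0) (x : L.carrier) (m : KacSpace W) :
    extend M φ (act W x m) = M.act x (extend M φ m) := by
  obtain ⟨z, y, p, rfl⟩ := GLSA.exists_add x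
  simp only [map_add, LinearMap.add_apply, act_coe_g0, act_coe_neg, act_coe_pos,
    extend_act0 hφ, extend_actNeg hφ hn, actPos_apply, extend_smul]

/-- The extension of a homomorphism of `𝔤₀`-supermodules `W → M` with values in the
`𝔤₋₁`-invariants to a homomorphism of `𝔤`-supermodules. -/
def extendHom (hev : ∀ w ∈ W.ev, φ w ∈ M.ev) (hod : ∀ w ∈ W.od, φ w ∈ M.od)
    (hφ : ∀ (z : L.g0) w, φ (W.act z w) = M.act z (φ w))
    (hn : ∀ y ∈ L.gneg, ∀ w, M.act y (φ w) = 0) : SHom (toSMod W) M where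
  toLin := extend M φ
  map_ev := fun m hm => by
    have hm : parity W m = m := sub_eq_zero.1 hm
    exact (mem_left_iff_parityInvol M.grading).2
      ((extend_parity hev hod m).symm.trans (congrArg _ hm))
  map_od := fun m hm => by
    have hm : parity W m = -m := add_eq_zero_iff_eq_neg.1 hm
    exact (mem_right_iff_parityInvol M.grading).2
      ((extend_parity hev hod m).symm.trans ((congrArg _ hm).trans (map_neg _ _)))
  equivar := fun x m => extend_act hφ hn x m

theorem act_eq_smul (x : L.gpos) (m : KacSpace W) : (toSMod W).act x m = ι ℂ x • m :=
  LinearMap.congr_fun (act_coe_pos x) m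

end KacSpace

section OppositeKacModule

open ExteriorAlgebra KacSpace

variable {L : GLSA} {W : SMod0 L} {K : SMod L} {η : W.carrier →ₗ[ℂ] K.carrier}

/-- The opposite Kac module is `Λ(𝔤₁) ⊗ W` as a vector space. -/
theorem IsKac'.extend_bijective (h : IsKac' W K η) : Bijective (extend K η) := by
  let G : SHom (toSMod W) K := extendHom h.map_ev h.map_od h.equivar h.neg_zero
  obtain ⟨F, hF, -⟩ := h.universal (toSMod W) (unit W)
    (fun w hw => by
      change parity W (unit W w) - unit W w = 0
      rw [parity_unit, parityInvol_left W.grading hw, sub_self])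
    (fun w hw => by
      change parity W (unit W w) + unit W w = 0
      rw [parity_unit, parityInvol_right W.grading hw, map_neg, neg_add_cancel])
    (fun z w => by
      change _ = act W z (unit W w)
      exact ((LinearMap.congr_fun (act_coe_g0 z) _).trans (act0_unit z w)).symm)
    (fun y hy w => by
      change act W y (unit W w) = 0
      rw [act_coe_neg ⟨y, hy⟩, actNeg_unit])
  constructor
  · refine Function.LeftInverse.injective (g := F.toLin) fun m => ?_
    induction m using KacSpace.induction with
    | unit w => exact (congrArg F.toLin (KacSpace.extend_unit w)).trans (hF w)
    | add m m' h h' =>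
      rw [map_add, map_add, h, h']
      rfl
    | smul x m h => rw [KacSpace.extend_smul, F.equivar, h, act_eq_smul]
  · obtain ⟨Φ, -, hΦ⟩ := h.universal K η h.map_ev h.map_od h.equivar h.neg_zero
    refine Function.RightInverse.surjective (g := F.toLin) fun k => ?_
    have h1 : G.comp F = SHom.id K :=
      (hΦ _ fun w => (congrArg G.toLin (hF w)).trans (extend_unit w)).trans (hΦ _ fun w => rfl).symm
    exact LinearMap.congr_fun (congrArg SHom.toLin h1) k

/-- The `𝔤₁`-invariants of the opposite Kac module of a simple module lie in each non-zero
subsupermodule. -/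
theorem IsKac'.invPos_le [FiniteDimensional ℂ L.gpos] (h : IsKac' W K η) (hW : W.IsSimple)
    {N : Submodule ℂ K.carrier} (hN : K.IsSubmod N) (hne : N ≠ ⊥) : K.invPos ≤ N := by
  have hN' := hN
  rw [SMod.isSubmod_iff] at hN'
  let b := Module.finBasis ℂ L.gpos
  have hrange : ∀ m ∈ K.invPos, ∃ w, m = extend K η (topProd b • unit W w) := by
    intro m hm
    obtain ⟨m, rfl⟩ := h.extend_bijective.2 m
    obtain ⟨m', rfl⟩ := exists_eq_topProd_smul b (m := m) fun x =>
      h.extend_bijective.1 (by rw [KacSpace.extend_smul, hm x x.2, map_zero])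
    obtain ⟨w, hw⟩ := topProd_smul_mem b m'
    exact ⟨w, by rw [hw]⟩
  let T : W.carrier →ₗ[ℂ] K.carrier :=
    extend K η ∘ₗ Algebra.lsmul ℂ ℂ (KacSpace W) (topProd b) ∘ₗ unit W
  have hT : W.IsSubmod (N.comap T) := by
    rw [SMod0.IsSubmod, le_inf_sup_inf_iff W.grading]
    constructor
    · intro z w hw
      obtain ⟨c, hc⟩ := act0_topProd_smul (W := W) b z
      have h1 : T (W.act z w) = K.act z (T w) - c • T w := by
        change extend K η (topProd b • unit W _) = K.act z (extend K η (topProd b • unit W w)) -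
          c • extend K η (topProd b • unit W w)
        rw [← extend_act0 h.equivar, hc, map_add, LinearMap.map_smul (extend K η) c,
          add_sub_cancel_left, act0_unit]
      rw [Submodule.mem_comap, h1]
      exact N.sub_mem (hN'.1 z _ hw) (N.smul_mem _ hw)
    · intro w hw
      obtain ⟨ε, hε⟩ := exists_sign_involute_topProd b
      have h1 : T (parityInvol W.grading w) = ε • parityInvol K.grading (T w) := by
        change extend K η (topProd b • unit W _) =
          ε • parityInvol K.grading (extend K η (topProd b • unit W w))
        rw [← extend_parity h.map_ev h.map_od, parity_smul_smul, parity_unit,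
          ← LinearMap.map_smul (extend K η) ε, ← smul_assoc, ← hε]
      rw [Submodule.mem_comap, h1]
      exact N.smul_mem _ (hN'.2 _ hw)
  obtain ⟨m, hmN, hm0, hm⟩ := exists_ne_zero_forall_eq_zero (fun i => K.act (b i))
    (fun i j m => K.act_pos_act_pos (b i) (b j) m) (fun i m => K.act_pos_act_self (b i) m)
    (fun i m hm => hN.1 _ m hm) hne Finset.univ
  have hminv : m ∈ K.invPos := by
    intro x hx
    have h1 : K.act ((∑ i, b.repr ⟨x, hx⟩ i • b i : L.gpos) : L.carrier) m = 0 := by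
      simp only [Submodule.coe_sum, Submodule.coe_smul, map_sum, map_smul, LinearMap.sum_apply,
        LinearMap.smul_apply]
      exact Finset.sum_eq_zero fun i hi => by rw [hm i hi, smul_zero]
    rwa [b.sum_repr] at h1
  obtain ⟨w, rfl⟩ := hrange m hminv
  have htop : N.comap T = ⊤ := by
    refine (hW.2 _ hT).resolve_left fun hbot => hm0 ?_
    have hw : w ∈ N.comap T := hmN
    rw [hbot, Submodule.mem_bot] at hw
    rw [hw, map_zero, smul_zero, map_zero]
  intro m hm
  obtain ⟨w, rfl⟩ := hrange m hm
  exact (htop ▸ Submodule.mem_top : w ∈ N.comap T)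

end OppositeKacModule

/-- The image of a homomorphism from a Kac module to the opposite Kac module of a simple module
is contained in each non-zero subsupermodule. -/
theorem range_le_of_isSubmod {L : GLSA} [FiniteDimensional ℂ L.gpos] {V W : SMod0 L}
    (hW : W.IsSimple) {K : SMod L} {η : V.carrier →ₗ[ℂ] K.carrier} (hK : IsKac V K η)
    {K' : SMod L} {η' : W.carrier →ₗ[ℂ] K'.carrier} (hK' : IsKac' W K' η') (f : SHom K K')
    {N : Submodule ℂ K'.carrier} (hN : K'.IsSubmod N) (hne : N ≠ ⊥) :
    LinearMap.range f.toLin ≤ N := by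
  rw [LinearMap.range_le_iff_comap, eq_top_iff, ← hK.generates]
  refine sInf_le ⟨f.isSubmod_comap hN, ?_⟩
  rintro _ ⟨v, rfl⟩
  refine hK'.invPos_le hW hN hne fun x hx => ?_
  rw [← f.equivar, hK.pos_zero x hx, map_zero]

/-- Let `V` and `W` be simple `𝔤₀`-supermodules.  Every non-zero
homomorphism of `𝔤`-supermodules `f : K(V) → K'(W)` has image equal to the socle of
`K'(W)`.  Consequently, if `K(V) ≅ K'(W)` as `𝔤`-supermodules, then both `K(V)` and
`K'(W)` are simple. -/
theorem statement_4 (L : GLSA)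
    [FiniteDimensional ℂ ↥L.gneg] [FiniteDimensional ℂ ↥L.gpos]
    (V W : SMod0 L) (hV : V.IsSimple) (hW : W.IsSimple)
    (K : SMod L) (η : V.carrier →ₗ[ℂ] K.carrier) (hK : IsKac V K η)
    (K' : SMod L) (η' : W.carrier →ₗ[ℂ] K'.carrier) (hK' : IsKac' W K' η') :
    (∀ f : SHom K K', f.toLin ≠ 0 → LinearMap.range f.toLin = K'.socle) ∧
    (SIso K K' → K.IsSimple ∧ K'.IsSimple) := by
  constructor
  · intro f hf
    have hS := f.isSubmod_range
    have hS0 : LinearMap.range f.toLin ≠ ⊥ := fun h => hf (LinearMap.range_eq_bot.1 h)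
    have hle := fun N => range_le_of_isSubmod hW hK hK' f (N := N)
    apply le_antisymm
    · refine le_sSup ⟨hS, hS0, fun N hN hNle => ?_⟩
      by_cases hN0 : N = ⊥
      · exact Or.inl hN0
      · exact Or.inr (le_antisymm hNle (hle N hN hN0))
    · refine sSup_le fun N hN => ?_
      rcases hN.2.2 _ hS (hle N hN.1 hN.2.1) with h | h
      · exact absurd h hS0
      · exact h.ge
  · rintro ⟨f, hf⟩
    have htop : ∀ N, K'.IsSubmod N → N ≠ ⊥ → N = ⊤ := fun N hN hN0 => by
      rw [eq_top_iff, ← LinearMap.range_eq_top.2 hf.2]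
      exact range_le_of_isSubmod hW hK hK' f hN hN0
    have hK'0 : (⊤ : Submodule ℂ K'.carrier) ≠ ⊥ := by
      intro h
      refine hW.1 (eq_bot_iff.2 fun w _ => hK'.injective ?_)
      rw [map_zero]
      exact (Submodule.mem_bot ℂ).1 (h ▸ Submodule.mem_top)
    refine ⟨⟨fun h => hK'0 ?_, fun N hN => ?_⟩, hK'0, fun N hN => or_iff_not_imp_left.2 (htop N hN)⟩
    · rw [← LinearMap.range_eq_top.2 hf.2, LinearMap.range_eq_map, h, Submodule.map_bot]
    · refine or_iff_not_imp_left.2 fun hN0 => ?_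
      have h := htop _ (f.isSubmod_map hN) fun h =>
        hN0 (Submodule.map_injective_of_injective hf.1 (h.trans (Submodule.map_bot _).symm))
      rw [← Submodule.comap_map_eq_of_injective hf.1 N, h, Submodule.comap_top]
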